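/- Let r > 0, set q = e^{−π√r}, and assume k_r ∈ (0,1) satisfies K(√(1 − k_r²)) = √r · K(k_r). Then arctanh(k_r) = 4·∑_{j=0}^{∞} arctanh(q^{j+1/2}). -/

import Mathlib

/-- The complete elliptic integral of the first kind
`K(x) = ∫₀^{π/2} dt / √(1 - x² sin² t)`. -/
noncomputable def Kint (x : ℝ) : ℝ :=
  ∫ t in (0 : ℝ)..(Real.pi / 2), 1 / Real.sqrt (1 - x ^ 2 * Real.sin t ^ 2)
/-- The inverse hyperbolic tangent. -/
noncomputable def arctanh (x : ℝ) : ℝ := Real.log ((1 + x) / (1 - x)) / 2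

open Filter Topology

noncomputable def wt (y : ℝ) (n k : ℕ) : ℝ :=
  ∏ i ∈ Finset.range k, (1 - y ^ (n - i)) / (1 - y ^ (n + 1 + i))

lemma wt_succ (y : ℝ) (n k : ℕ) :
    wt y n (k + 1) = wt y n k * ((1 - y ^ (n - k)) / (1 - y ^ (n + 1 + k))) := by
  rw [wt, wt, Finset.prod_range_succ]

lemma wt_eq_zero (y : ℝ) (n k : ℕ) (h : n < k) : wt y n k = 0 := by
  apply Finset.prod_eq_zero (Finset.mem_range.2 h)
  simp

lemma wt_nonneg {y : ℝ} (hy0 : 0 < y) (hy1 : y < 1) (n k : ℕ) : 0 ≤ wt y n k := by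
  apply Finset.prod_nonneg
  intro i _
  have h1 := pow_le_one₀ hy0.le hy1.le (n := n - i)
  have h2 := pow_le_one₀ hy0.le hy1.le (n := n + 1 + i)
  exact div_nonneg (by linarith) (by linarith)

lemma wt_le_one {y : ℝ} (hy0 : 0 < y) (hy1 : y < 1) (n k : ℕ) : wt y n k ≤ 1 := by
  apply Finset.prod_le_one
  · intro i _
    have h1 := pow_le_one₀ hy0.le hy1.le (n := n - i)
    have h2 := pow_le_one₀ hy0.le hy1.le (n := n + 1 + i)
    exact div_nonneg (by linarith) (by linarith)
  · intro i _
    have h2 := pow_lt_one₀ hy0.le hy1 (n := n + 1 + i) (by omega)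
    have h3 := pow_le_pow_of_le_one hy0.le hy1.le (m := n - i) (n := n + 1 + i) (by omega)
    rw [div_le_one (by linarith)]
    linarith

lemma wt_tendsto {y : ℝ} (hy0 : 0 < y) (hy1 : y < 1) (k : ℕ) :
    Tendsto (fun n => wt y n k) atTop (𝓝 1) := by
  have h0 := tendsto_pow_atTop_nhds_zero_of_lt_one hy0.le hy1
  have : (1:ℝ) = ∏ i ∈ Finset.range k, (1 - 0) / (1 - 0) := by simp
  rw [this]
  apply tendsto_finsetProd
  intro i _
  apply Tendsto.div
  · exact tendsto_const_nhds.sub (h0.comp (tendsto_sub_atTop_nat i))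
  · refine tendsto_const_nhds.sub (h0.comp ?_)
    have := tendsto_add_atTop_nat (1 + i)
    simpa [add_assoc] using this
  · simp

lemma wt_up {y : ℝ} (hy0 : 0 < y) (hy1 : y < 1) (n k : ℕ) :
    wt y (n + 1) (k + 1) = wt y n k * (1 - y ^ (n + 1)) ^ 2 /
      ((1 - y ^ (n + 1 + k)) * (1 - y ^ (n + 2 + k))) := by
  have hp : ∀ m : ℕ, 1 - y ^ (m + 1) ≠ 0 := fun m => by
    have := pow_lt_one₀ hy0.le hy1 (n := m + 1) (by omega)
    linarith
  induction k with
  | zero =>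
    have h1 := hp n
    have h2 := hp (n + 1)
    simp [wt]
    field_simp
  | succ k ih =>
    rw [wt_succ, ih, wt_succ]
    have h1 := hp (n + k)
    have h2 := hp (n + k + 1)
    have h3 := hp (n + k + 2)
    have e : n + 1 - (k + 1) = n - k := by omega
    rw [e]
    have e1 : n + 1 + k = n + k + 1 := by omega
    have e2 : n + 2 + k = n + k + 1 + 1 := by omega
    have e3 : n + 1 + 1 + (k + 1) = n + k + 2 + 1 := by omega
    have e4 : n + 1 + (k + 1) = n + k + 1 + 1 := by omega
    have e5 : n + 2 + (k + 1) = n + k + 2 + 1 := by omega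
    rw [e1, e2, e3, e4]
    field_simp

noncomputable def cc (y : ℝ) (n : ℕ) : ℝ :=
  (1 - y ^ (n + 1)) ^ 2 / ((1 - y ^ (2 * n + 1)) * (1 - y ^ (2 * n + 2)))

lemma cc_pos {y : ℝ} (hy0 : 0 < y) (hy1 : y < 1) (n : ℕ) : 0 < cc y n := by
  have hp : ∀ m : ℕ, 0 < 1 - y ^ (m + 1) := fun m => by
    have := pow_lt_one₀ hy0.le hy1 (n := m + 1) (by omega)
    linarith
  have h1 := hp n
  have h2 := hp (2 * n)
  have h3 := hp (2 * n + 1)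
  unfold cc
  positivity

lemma wt_rec_zero {y : ℝ} (hy0 : 0 < y) (hy1 : y < 1) (n : ℕ) :
    1 = cc y n * ((1 + y ^ (2 * n + 1)) + 2 * y ^ (n + 1) * wt y n 1) := by
  have hp : ∀ m : ℕ, 1 - y ^ (m + 1) ≠ 0 := fun m => by
    have := pow_lt_one₀ hy0.le hy1 (n := m + 1) (by omega)
    linarith
  have h1 := hp n
  have h2 := hp (2 * n)
  have h3 := hp (2 * n + 1)
  simp only [cc, wt, Finset.prod_range_one]
  simp only [Nat.sub_zero, add_zero]
  rw [show 2 * n + 2 = 2 * n + 1 + 1 by omega]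
  field_simp
  ring

lemma wt_rec_succ {y : ℝ} (hy0 : 0 < y) (hy1 : y < 1) (d m : ℕ) :
    wt y (d + m + 1) (m + 1) = cc y (d + m) * ((1 + y ^ (2 * (d + m) + 1)) * wt y (d + m) (m + 1)
      + y ^ d * wt y (d + m) m + y ^ (d + 2 * m + 2) * wt y (d + m) (m + 2)) := by
  have hp : ∀ m : ℕ, 1 - y ^ (m + 1) ≠ 0 := fun m => by
    have := pow_lt_one₀ hy0.le hy1 (n := m + 1) (by omega)
    linarith
  rw [wt_up hy0 hy1, wt_succ y (d + m) (m + 1), wt_succ y (d + m) m]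
  set W := wt y (d + m) m
  rcases d with _ | d
  · simp only [cc]
    have h1 := hp (2 * m)
    have h2 := hp (2 * m + 1)
    simp
    rw [show m + 1 + m = 2 * m + 1 by omega, show m + 2 + m = 2 * m + 1 + 1 by omega,
      show 2 * m + 2 = 2 * m + 1 + 1 by omega]
    field_simp
  · have h1 := hp (2 * (d + 1 + m))
    have h2 := hp (2 * (d + 1 + m) + 1)
    have h3 := hp (d + 1 + 2 * m)
    have h4 := hp (d + 1 + 2 * m + 1)
    simp only [cc]
    rw [show d + 1 + m - m = d + 1 by omega, show d + 1 + m - (m + 1) = d by omega,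
      show d + 1 + m + 1 + m = d + 1 + 2 * m + 1 by omega,
      show d + 1 + m + 2 + m = d + 1 + 2 * m + 1 + 1 by omega,
      show d + 1 + m + 1 + (m + 1) = d + 1 + 2 * m + 1 + 1 by omega,
      show 2 * (d + 1 + m) + 2 = 2 * (d + 1 + m) + 1 + 1 by omega]
    field_simp
    ring

noncomputable def gq (q : ℝ) (n : ℤ) : ℝ := q ^ (n ^ 2)

noncomputable def th (e q : ℝ) : ℝ := ∑' n : ℤ, e ^ n * gq q n

lemma gq_pos {q : ℝ} (hq0 : 0 < q) (n : ℤ) : 0 < gq q n := zpow_pos hq0 _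

lemma gq_neg (q : ℝ) (n : ℤ) : gq q (-n) = gq q n := by simp [gq]

lemma gq_summable {q : ℝ} (hq0 : 0 < q) (hq1 : q < 1) : Summable (gq q) := by
  have hn : Summable (fun n : ℕ => gq q n) := by
    refine Summable.of_nonneg_of_le (fun n => (gq_pos hq0 _).le) ?_
      (summable_geometric_of_lt_one hq0.le hq1)
    intro n
    have : gq q n = q ^ (n ^ 2) := by
      simp only [gq]; exact_mod_cast zpow_natCast q (n ^ 2)
    rw [this]
    exact pow_le_pow_of_le_one hq0.le hq1.le (Nat.le_self_pow (by norm_num) n)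
  refine Summable.of_nat_of_neg hn ?_
  simpa [gq_neg] using hn

lemma sgn_abs {e : ℝ} (he : e = 1 ∨ e = -1) (n : ℤ) : |e ^ n| = 1 := by
  rcases he with rfl | rfl <;> simp [abs_zpow]

lemma th_summable_norm {e q : ℝ} (he : e = 1 ∨ e = -1) (hq0 : 0 < q) (hq1 : q < 1) :
    Summable (fun n : ℤ => ‖e ^ n * gq q n‖) := by
  refine (gq_summable hq0 hq1).congr fun n => ?_
  rw [Real.norm_eq_abs, abs_mul, sgn_abs he, abs_of_pos (gq_pos hq0 n), one_mul]

noncomputable def uu (q : ℝ) (n : ℕ) (k : ℤ) : ℝ := gq q k * wt (q ^ 2) n k.natAbs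

lemma uu_neg (q : ℝ) (n : ℕ) (k : ℤ) : uu q n (-k) = uu q n k := by
  simp [uu, gq_neg]

lemma gq_nat (q : ℝ) (n : ℕ) : gq q n = q ^ (n ^ 2) := by
  simp only [gq]; exact_mod_cast zpow_natCast q (n ^ 2)

lemma uu_nat (q : ℝ) (n k : ℕ) : uu q n k = q ^ (k ^ 2) * wt (q ^ 2) n k := by
  simp [uu, gq_nat]

lemma uu_rec_nat {q : ℝ} (hq0 : 0 < q) (hq1 : q < 1) (n m : ℕ) :
    uu q (n + 1) m = cc (q ^ 2) n * ((1 + (q ^ (2 * n + 1)) ^ 2) * uu q n m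
      + q ^ (2 * n + 1) * (uu q n (m - 1) + uu q n (m + 1))) := by
  have hy0 : 0 < q ^ 2 := by positivity
  have hy1 : q ^ 2 < 1 := pow_lt_one₀ hq0.le hq1 (by norm_num)
  rcases m with _ | m
  · have e1 : uu q n (((0 : ℕ) : ℤ) - 1) = uu q n (1 : ℕ) := by
      rw [← uu_neg]; simp
    have e2 : uu q n (((0 : ℕ) : ℤ) + 1) = uu q n (1 : ℕ) := by simp
    rw [e1, e2, uu_nat, uu_nat, uu_nat]
    have := wt_rec_zero hy0 hy1 n
    have z : ∀ n, wt (q ^ 2) n 0 = 1 := fun n => by simp [wt]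
    rw [z, z]
    simp only [pow_two 0, mul_zero, pow_zero, mul_one]
    refine this.trans ?_
    ring
  · have e1 : uu q n (((m + 1 : ℕ) : ℤ) - 1) = uu q n (m : ℕ) := by simp
    have e2 : uu q n (((m + 1 : ℕ) : ℤ) + 1) = uu q n (m + 2 : ℕ) := by
      push_cast; ring_nf
    rw [e1, e2, uu_nat, uu_nat, uu_nat, uu_nat]
    by_cases h : m ≤ n
    · obtain ⟨d, rfl⟩ := Nat.exists_eq_add_of_le' h
      rw [wt_rec_succ hy0 hy1]
      ring
    · rw [wt_eq_zero _ _ (m + 1) (by omega), wt_eq_zero _ _ (m + 1) (by omega),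
        wt_eq_zero _ _ m (by omega), wt_eq_zero _ _ (m + 2) (by omega)]
      ring

lemma uu_rec {q : ℝ} (hq0 : 0 < q) (hq1 : q < 1) (n : ℕ) (k : ℤ) :
    uu q (n + 1) k = cc (q ^ 2) n * ((1 + (q ^ (2 * n + 1)) ^ 2) * uu q n k
      + q ^ (2 * n + 1) * (uu q n (k - 1) + uu q n (k + 1))) := by
  obtain ⟨m, rfl | rfl⟩ := k.eq_nat_or_neg
  · exact uu_rec_nat hq0 hq1 n m
  · have := uu_rec_nat hq0 hq1 n m
    rw [uu_neg, uu_neg, this, ← uu_neg q n (-(m:ℤ) - 1), ← uu_neg q n (-(m:ℤ) + 1)]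
    rw [show -(-(m:ℤ) - 1) = m + 1 by ring, show -(-(m:ℤ) + 1) = m - 1 by ring]
    ring

lemma uu_bound {e q : ℝ} (he : e = 1 ∨ e = -1) (hq0 : 0 < q) (hq1 : q < 1) (n : ℕ) (k : ℤ) :
    ‖e ^ k * uu q n k‖ ≤ gq q k := by
  have hy0 : 0 < q ^ 2 := by positivity
  have hy1 : q ^ 2 < 1 := pow_lt_one₀ hq0.le hq1 (by norm_num)
  rw [Real.norm_eq_abs, abs_mul, sgn_abs he, one_mul, uu, abs_mul, abs_of_pos (gq_pos hq0 k),
    abs_of_nonneg (wt_nonneg hy0 hy1 _ _)]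
  exact mul_le_of_le_one_right (gq_pos hq0 k).le (wt_le_one hy0 hy1 _ _)

lemma uu_summable {e q : ℝ} (he : e = 1 ∨ e = -1) (hq0 : 0 < q) (hq1 : q < 1) (n : ℕ) :
    Summable (fun k : ℤ => e ^ k * uu q n k) :=
  Summable.of_norm_bounded (gq_summable hq0 hq1) (uu_bound he hq0 hq1 n)

noncomputable def SS (e q : ℝ) (n : ℕ) : ℝ := ∑' k : ℤ, e ^ k * uu q n k

lemma SS_succ {e q : ℝ} (he : e = 1 ∨ e = -1) (hq0 : 0 < q) (hq1 : q < 1) (n : ℕ) :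
    SS e q (n + 1) = cc (q ^ 2) n * (1 + e * q ^ (2 * n + 1)) ^ 2 * SS e q n := by
  have hs := (uu_summable he hq0 hq1 n).hasSum
  have e0 : e ≠ 0 := by rcases he with rfl | rfl <;> norm_num
  have ee : e * e = 1 := by rcases he with rfl | rfl <;> norm_num
  have h1 : HasSum (fun k : ℤ => e ^ (k - 1) * uu q n (k - 1)) (SS e q n) := by
    exact (Equiv.hasSum_iff (Equiv.subRight (1:ℤ)) (f := fun k : ℤ => e ^ k * uu q n k)).2 hs
  have h2 : HasSum (fun k : ℤ => e ^ (k + 1) * uu q n (k + 1)) (SS e q n) := by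
    exact (Equiv.hasSum_iff (Equiv.addRight (1:ℤ)) (f := fun k : ℤ => e ^ k * uu q n k)).2 hs
  have h3 := ((hs.mul_left (1 + (q ^ (2 * n + 1)) ^ 2)).add
    ((h1.add h2).mul_left (e * q ^ (2 * n + 1)))).mul_left (cc (q ^ 2) n)
  have h4 := (uu_summable he hq0 hq1 (n + 1)).hasSum
  have hk : (fun k : ℤ => e ^ k * uu q (n + 1) k) = (fun k : ℤ => cc (q ^ 2) n *
      ((1 + (q ^ (2 * n + 1)) ^ 2) * (e ^ k * uu q n k) + e * q ^ (2 * n + 1) *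
        (e ^ (k - 1) * uu q n (k - 1) + e ^ (k + 1) * uu q n (k + 1)))) := by
    funext k
    rw [uu_rec hq0 hq1, zpow_add_one₀ e0, zpow_sub_one₀ e0]
    have ei : e⁻¹ = e := by rcases he with rfl | rfl <;> norm_num
    rw [ei]
    linear_combination (-(cc (q ^ 2) n * q ^ (2 * n + 1) * e ^ k * (uu q n (k - 1) + uu q n (k + 1)))) * ee
  rw [← hk] at h3
  have h5 : SS e q (n + 1) = _ := h4.unique h3
  rw [h5]
  change _ * (_ * SS e q n + _) = _
  linear_combination (-(cc (q ^ 2) n * (q ^ (2 * n + 1)) ^ 2 * SS e q n)) * ee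

lemma SS_zero (e q : ℝ) : SS e q 0 = 1 := by
  rw [SS, tsum_eq_single 0]
  · simp [uu, gq, wt]
  · intro k hk
    rw [uu, wt_eq_zero _ _ _ (by omega)]
    simp

lemma SS_tendsto {e q : ℝ} (he : e = 1 ∨ e = -1) (hq0 : 0 < q) (hq1 : q < 1) :
    Tendsto (SS e q) atTop (𝓝 (th e q)) := by
  have hy0 : 0 < q ^ 2 := by positivity
  have hy1 : q ^ 2 < 1 := pow_lt_one₀ hq0.le hq1 (by norm_num)
  refine tendsto_tsum_of_dominated_convergence (gq_summable hq0 hq1) ?_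
    (Eventually.of_forall fun n => uu_bound he hq0 hq1 n)
  intro k
  have := ((wt_tendsto hy0 hy1 k.natAbs).const_mul (gq q k)).const_mul (e ^ k)
  simpa [uu] using this

lemma SS_prod {e q : ℝ} (he : e = 1 ∨ e = -1) (hq0 : 0 < q) (hq1 : q < 1) (n : ℕ) :
    SS e q n = (∏ j ∈ Finset.range n, cc (q ^ 2) j) *
      ∏ j ∈ Finset.range n, (1 + e * q ^ (2 * j + 1)) ^ 2 := by
  induction n with
  | zero => simp [SS_zero]
  | succ n ih =>
    rw [SS_succ he hq0 hq1, ih, Finset.prod_range_succ, Finset.prod_range_succ]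
    ring

lemma th_ratio {q : ℝ} (hq0 : 0 < q) (hq1 : q < 1) (h4 : th (-1) q ≠ 0) :
    Tendsto (fun n => ∏ j ∈ Finset.range n, ((1 + q ^ (2 * j + 1)) / (1 - q ^ (2 * j + 1))) ^ 2)
      atTop (𝓝 (th 1 q / th (-1) q)) := by
  have hy0 : 0 < q ^ 2 := by positivity
  have hy1 : q ^ 2 < 1 := pow_lt_one₀ hq0.le hq1 (by norm_num)
  refine ((SS_tendsto (Or.inl rfl) hq0 hq1).div (SS_tendsto (Or.inr rfl) hq0 hq1) h4).congr ?_
  intro n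
  have : (∏ j ∈ Finset.range n, cc (q ^ 2) j) ≠ 0 :=
    Finset.prod_ne_zero_iff.2 fun j _ => (cc_pos hy0 hy1 j).ne'
  rw [Pi.div_apply, SS_prod (Or.inl rfl) hq0 hq1, SS_prod (Or.inr rfl) hq0 hq1,
    mul_div_mul_left _ _ this, ← Finset.prod_div_distrib]
  refine Finset.prod_congr rfl fun j _ => ?_
  rw [div_pow]
  ring

/-! double sums -/

lemma parity_sum (F : ℤ × ℤ → ℝ) (hF : ∀ m n : ℤ, (m + n) % 2 = 1 → F (m, n) = 0) :
    ∑' p : ℤ × ℤ, F (p.1 + p.2, p.1 - p.2) = ∑' p, F p := by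
  have hi : Function.Injective (fun p : ℤ × ℤ => (p.1 + p.2, p.1 - p.2)) := by
    rintro ⟨a, b⟩ ⟨c, d⟩ h
    simp only [Prod.mk.injEq] at h ⊢
    omega
  refine hi.tsum_eq (f := F) ?_
  rintro ⟨m, n⟩ h
  have h2 : (m + n) % 2 = 0 := by
    by_contra h3
    exact h (hF m n (by omega))
  refine ⟨((m + n) / 2, (m - n) / 2), ?_⟩
  simp only [Prod.mk.injEq]
  omega

lemma gq_mul {q : ℝ} (hq0 : 0 < q) (a b : ℤ) :
    gq q (a + b) * gq q (a - b) = gq (q ^ 2) a * gq (q ^ 2) b := by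
  simp only [gq]
  have : q ^ 2 = q ^ (2 : ℤ) := by norm_cast
  rw [this, ← zpow_mul, ← zpow_mul, ← zpow_add₀ hq0.ne', ← zpow_add₀ hq0.ne']
  congr 1
  ring

lemma th_mul {e f q : ℝ} (he : e = 1 ∨ e = -1) (hf : f = 1 ∨ f = -1) (hq0 : 0 < q) (hq1 : q < 1) :
    HasSum (fun p : ℤ × ℤ => (e ^ p.1 * gq q p.1) * (f ^ p.2 * gq q p.2)) (th e q * th f q) := by
  have h1 := th_summable_norm he hq0 hq1
  have h2 := th_summable_norm hf hq0 hq1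
  rw [th, th, tsum_mul_tsum_of_summable_norm h1 h2]
  exact (summable_mul_of_summable_norm h1 h2).hasSum

lemma sgn_odd {m n : ℤ} (h : (m + n) % 2 = 1) : (-1 : ℝ) ^ m = -(-1) ^ n := by
  rcases Int.even_or_odd n with hn | hn
  · have hm : Odd m := by rw [Int.odd_iff]; rw [Int.even_iff] at hn; omega
    rw [hm.neg_one_zpow, hn.neg_one_zpow]
  · have hm : Even m := by rw [Int.even_iff]; rw [Int.odd_iff] at hn; omega
    rw [hm.neg_one_zpow, hn.neg_one_zpow]; norm_num

lemma sgn_sub (a b : ℤ) : (-1 : ℝ) ^ (a - b) = (-1) ^ a * (-1) ^ b := by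
  rw [zpow_sub₀ (by norm_num)]
  rcases Int.even_or_odd b with hn | hn <;> rw [hn.neg_one_zpow] <;> simp [div_neg]

lemma sgn_add (a b : ℤ) : (-1 : ℝ) ^ (a + b) = (-1) ^ a * (-1) ^ b := by
  rw [zpow_add₀ (by norm_num)]

lemma sgn_mul_self (a : ℤ) : (-1 : ℝ) ^ a * (-1) ^ a = 1 := by
  rcases Int.even_or_odd a with hn | hn <;> rw [hn.neg_one_zpow] <;> norm_num

lemma th_am {q : ℝ} (hq0 : 0 < q) (hq1 : q < 1) :
    th 1 q ^ 2 + th (-1) q ^ 2 = 2 * th 1 (q ^ 2) ^ 2 := by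
  have hy0 : 0 < q ^ 2 := by positivity
  have hy1 : q ^ 2 < 1 := pow_lt_one₀ hq0.le hq1 (by norm_num)
  have h1 := th_mul (Or.inl rfl) (Or.inl rfl) hq0 hq1
  have h2 := th_mul (Or.inr rfl) (Or.inr rfl) hq0 hq1
  have h3 := th_mul (Or.inl rfl) (Or.inl rfl) hy0 hy1
  rw [pow_two, pow_two, ← (h1.add h2).tsum_eq, pow_two (th 1 (q ^ 2)), ← h3.tsum_eq,
    ← tsum_mul_left, ← parity_sum]
  · refine tsum_congr fun p => ?_
    obtain ⟨a, b⟩ := p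
    have := gq_mul hq0 a b
    simp only [one_zpow, sgn_sub, sgn_add]
    have ha := sgn_mul_self a
    have hb := sgn_mul_self b
    linear_combination (1 + ((-1) ^ b * (-1) ^ b)) * this * 1 + (gq q (a + b) * gq q (a - b)) * ((-1) ^ b * (-1) ^ b) * ha + gq (q ^ 2) a * gq (q ^ 2) b * hb
  · intro m n h
    simp only [one_zpow, sgn_odd h]
    linear_combination (-gq q m * gq q n) * sgn_mul_self n

lemma th_gm {q : ℝ} (hq0 : 0 < q) (hq1 : q < 1) :
    th 1 q * th (-1) q = th (-1) (q ^ 2) ^ 2 := by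
  have hy0 : 0 < q ^ 2 := by positivity
  have hy1 : q ^ 2 < 1 := pow_lt_one₀ hq0.le hq1 (by norm_num)
  have h1 := th_mul (Or.inl rfl) (Or.inr rfl) hq0 hq1
  have h2 := th_mul (Or.inr rfl) (Or.inl rfl) hq0 hq1
  have h3 := th_mul (Or.inr rfl) (Or.inr rfl) hy0 hy1
  have : th 1 q * th (-1) q + th (-1) q * th 1 q = 2 * th (-1) (q ^ 2) ^ 2 := by
    rw [← (h1.add h2).tsum_eq, pow_two (th (-1) (q ^ 2)), ← h3.tsum_eq,
      ← tsum_mul_left, ← parity_sum]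
    · refine tsum_congr fun p => ?_
      obtain ⟨a, b⟩ := p
      have := gq_mul hq0 a b
      simp only [one_zpow, sgn_sub, sgn_add]
      linear_combination (2 * (-1) ^ a * (-1) ^ b) * this
    · intro m n h
      simp only [one_zpow, sgn_odd h]
      ring
  linarith

lemma gq_pow (q : ℝ) (m : ℕ) (k : ℤ) : gq (q ^ m) k = gq q k ^ m := by
  simp only [gq]
  rw [← zpow_natCast, ← zpow_natCast, ← zpow_mul, ← zpow_mul, mul_comm]

lemma gq_lt_one {q : ℝ} (hq0 : 0 < q) (hq1 : q < 1) {k : ℤ} (hk : k ≠ 0) : gq q k < 1 := by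
  have : gq q k = gq q k.natAbs := by
    simp only [gq]; simp
  rw [this, gq_nat]
  exact pow_lt_one₀ hq0.le hq1 (by positivity)

lemma th_tendsto {e q : ℝ} (he : e = 1 ∨ e = -1) (hq0 : 0 < q) (hq1 : q < 1) :
    Tendsto (fun n : ℕ => th e (q ^ (2 ^ n))) atTop (𝓝 1) := by
  have h1 : (1 : ℝ) = ∑' k : ℤ, (if k = 0 then (1:ℝ) else 0) := by simp
  rw [h1]
  have hg : ∀ k, gq q k ≤ 1 := fun k => by
    by_cases hk : k = 0
    · subst hk; simp [gq]
    · exact (gq_lt_one hq0 hq1 hk).le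
  refine tendsto_tsum_of_dominated_convergence (gq_summable hq0 hq1) ?_
    (Eventually.of_forall fun n k => ?_)
  · intro k
    by_cases hk : k = 0
    · subst hk; simp [gq]
    · simp only [hk, if_false, gq_pow]
      have h2 : Tendsto (fun n : ℕ => 2 ^ n) atTop atTop :=
        tendsto_pow_atTop_atTop_of_one_lt (by norm_num : 1 < 2)
      have := (tendsto_pow_atTop_nhds_zero_of_lt_one (gq_pos hq0 k).le (gq_lt_one hq0 hq1 hk)).comp h2
      simpa using this.const_mul (e ^ k)
  · rw [Real.norm_eq_abs, abs_mul, sgn_abs he, one_mul, gq_pow, abs_of_pos (pow_pos (gq_pos hq0 k) _)]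
    exact pow_le_of_le_one (gq_pos hq0 k).le (hg k) (by positivity)

lemma th_pos {q : ℝ} (hq0 : 0 < q) (hq1 : q < 1) : 0 < th 1 q := by
  rw [th]
  simp only [one_zpow, one_mul]
  exact (gq_summable hq0 hq1).tsum_pos (fun k => (gq_pos hq0 k).le) 0 (gq_pos hq0 0)

lemma th_ne {q : ℝ} (hq0 : 0 < q) (hq1 : q < 1) : th (-1) q ≠ 0 := by
  intro h
  have : ∀ n : ℕ, th (-1) (q ^ (2 ^ n)) = 0 := by
    intro n
    induction n with
    | zero => simpa using h
    | succ n ih =>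
      have := th_gm (q := q ^ (2 ^ n)) (by positivity) (pow_lt_one₀ hq0.le hq1 (by positivity))
      rw [ih, ← pow_mul, ← pow_succ] at this
      simpa using this.symm
  have h2 := th_tendsto (Or.inr rfl) hq0 hq1
  simp only [this] at h2
  exact zero_ne_one (tendsto_nhds_unique tendsto_const_nhds h2)

lemma th_exp (s : ℝ) : th 1 (Real.exp (-Real.pi * s)) =
    ∑' n : ℤ, Real.exp (-Real.pi * s * (n : ℝ) ^ 2) := by
  rw [th]
  refine tsum_congr fun n => ?_
  rw [one_zpow, one_mul, gq, ← Real.rpow_intCast, ← Real.exp_mul]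
  congr 1
  push_cast
  ring

lemma th_modular {s : ℝ} (hs : 0 < s) : th 1 (Real.exp (-Real.pi * s⁻¹)) ^ 2 =
    s * th 1 (Real.exp (-Real.pi * s)) ^ 2 := by
  rw [th_exp s, Real.tsum_exp_neg_mul_int_sq hs, th_exp s⁻¹, ← Real.sqrt_eq_rpow, mul_pow, div_pow,
    Real.sq_sqrt hs.le]
  field_simp

noncomputable def TT (s : ℝ) : ℝ := th 1 (Real.exp (-Real.pi * s)) ^ 2
noncomputable def FF (s : ℝ) : ℝ := th (-1) (Real.exp (-Real.pi * s)) ^ 2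

lemma q_lt {s : ℝ} (hs : 0 < s) : Real.exp (-Real.pi * s) < 1 := by
  rw [Real.exp_lt_one_iff]
  have := mul_pos Real.pi_pos hs
  linarith

lemma q_sq (s : ℝ) : Real.exp (-Real.pi * s) ^ 2 = Real.exp (-Real.pi * (2 * s)) := by
  rw [← Real.exp_nat_mul]; congr 1; push_cast; ring

lemma TT_pos {s : ℝ} (hs : 0 < s) : 0 < TT s := by
  have := th_pos (Real.exp_pos _) (q_lt hs)
  unfold TT; positivity

lemma FF_pos {s : ℝ} (hs : 0 < s) : 0 < FF s := by
  have := th_ne (Real.exp_pos _) (q_lt hs)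
  unfold FF; positivity

lemma TF_am {s : ℝ} (hs : 0 < s) : TT s + FF s = 2 * TT (2 * s) := by
  have := th_am (Real.exp_pos _) (q_lt hs)
  rwa [q_sq] at this

lemma TF_gm {s : ℝ} (hs : 0 < s) : TT s * FF s = FF (2 * s) ^ 2 := by
  have := th_gm (Real.exp_pos _) (q_lt hs)
  rw [q_sq] at this
  rw [TT, FF, FF, ← mul_pow, this]

lemma TT_inv {s : ℝ} (hs : 0 < s) : TT s⁻¹ = s * TT s := th_modular hs

lemma q_pow (s : ℝ) (n : ℕ) :
    Real.exp (-Real.pi * s) ^ (2 ^ n) = Real.exp (-Real.pi * (2 ^ n * s)) := by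
  rw [← Real.exp_nat_mul]; congr 1; push_cast; ring

lemma TT_tendsto {s : ℝ} (hs : 0 < s) : Tendsto (fun n : ℕ => TT (2 ^ n * s)) atTop (𝓝 1) := by
  have := (th_tendsto (Or.inl rfl) (Real.exp_pos _) (q_lt hs)).pow 2
  simpa only [TT, q_pow, one_pow] using this

lemma FF_tendsto {s : ℝ} (hs : 0 < s) : Tendsto (fun n : ℕ => FF (2 ^ n * s)) atTop (𝓝 1) := by
  have := (th_tendsto (Or.inr rfl) (Real.exp_pos _) (q_lt hs)).pow 2
  simpa only [FF, q_pow, one_pow] using this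

/-! elliptic integrals -/

noncomputable def JJ (a b : ℝ) : ℝ :=
  ∫ t in (0 : ℝ)..(Real.pi / 2), 1 / Real.sqrt (a ^ 2 * Real.cos t ^ 2 + b ^ 2 * Real.sin t ^ 2)

lemma JJ_eq {a b : ℝ} (_ha : 0 < a) (hb : 0 < b) :
    JJ a b = ∫ x in Set.Ioi (0 : ℝ), 1 / Real.sqrt ((x ^ 2 + a ^ 2) * (x ^ 2 + b ^ 2)) := by
  have hc : ∀ t ∈ Set.Ioo 0 (Real.pi / 2), 0 < Real.cos t := fun t ht =>
    Real.cos_pos_of_mem_Ioo ⟨by linarith [ht.1, Real.pi_pos], ht.2⟩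
  have him : (fun t => b * Real.tan t) '' Set.Ioo 0 (Real.pi / 2) = Set.Ioi 0 := by
    ext x
    constructor
    · rintro ⟨t, ht, rfl⟩
      exact mul_pos hb (Real.tan_pos_of_pos_of_lt_pi_div_two ht.1 ht.2)
    · intro hx
      refine ⟨Real.arctan (x / b), ⟨Real.arctan_pos.2 (div_pos hx hb), Real.arctan_lt_pi_div_two _⟩, ?_⟩
      simp only [Real.tan_arctan]
      field_simp
  have hinj : Set.InjOn (fun t => b * Real.tan t) (Set.Ioo 0 (Real.pi / 2)) := by
    intro x hx y hy h
    have h' : Real.tan x = Real.tan y := mul_left_cancel₀ hb.ne' h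
    exact Real.injOn_tan ⟨by linarith [hx.1, Real.pi_pos], hx.2⟩
      ⟨by linarith [hy.1, Real.pi_pos], hy.2⟩ h'
  have key := MeasureTheory.integral_image_eq_integral_abs_deriv_smul
    (f := fun t => b * Real.tan t) (f' := fun t => b * (1 / Real.cos t ^ 2))
    (s := Set.Ioo 0 (Real.pi / 2)) measurableSet_Ioo
    (fun t ht => ((Real.hasDerivAt_tan (hc t ht).ne').const_mul b).hasDerivWithinAt) hinj
    (fun x => 1 / Real.sqrt ((x ^ 2 + a ^ 2) * (x ^ 2 + b ^ 2)))
  rw [him] at key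
  rw [key, JJ, intervalIntegral.integral_of_le (by positivity), MeasureTheory.integral_Ioc_eq_integral_Ioo]
  refine MeasureTheory.setIntegral_congr_fun measurableSet_Ioo fun t ht => ?_
  have hct := hc t ht
  simp only [smul_eq_mul]
  have h1 : ((b * Real.tan t) ^ 2 + a ^ 2) * ((b * Real.tan t) ^ 2 + b ^ 2) =
      (a ^ 2 * Real.cos t ^ 2 + b ^ 2 * Real.sin t ^ 2) * (b / Real.cos t ^ 2) ^ 2 := by
    rw [Real.tan_eq_sin_div_cos]
    have := Real.sin_sq_add_cos_sq t
    field_simp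
    linear_combination (b ^ 2 * Real.sin t ^ 2 + a ^ 2 * Real.cos t ^ 2) * this
  rw [h1, Real.sqrt_mul (by positivity), Real.sqrt_sq (by positivity), abs_of_pos (by positivity)]
  have : 0 < b / Real.cos t ^ 2 := by positivity
  rw [mul_one_div, mul_one_div, div_mul_eq_div_div_swap, div_self this.ne']

lemma JJ_step {a b : ℝ} (ha : 0 < a) (hb : 0 < b) :
    JJ ((a + b) / 2) (Real.sqrt (a * b)) = JJ a b := by
  have hab : 0 < a * b := mul_pos ha hb
  rw [JJ_eq (by positivity) (by positivity), JJ_eq ha hb]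
  rw [Real.sq_sqrt hab.le]
  set f : ℝ → ℝ := fun x => 1 / Real.sqrt ((x ^ 2 + ((a + b) / 2) ^ 2) * (x ^ 2 + a * b)) with hf
  have h2 : ∫ x, f x = 2 * ∫ x in Set.Ioi (0:ℝ), f x := by
    rw [← integral_comp_abs]
    simp [hf]
  have him : (fun x : ℝ => (x - a * b / x) / 2) '' Set.Ioi 0 = Set.univ := by
    rw [Set.eq_univ_iff_forall]
    intro u
    have hlt : |u| < Real.sqrt (u ^ 2 + a * b) := by
      rw [← Real.sqrt_sq_eq_abs]
      exact Real.sqrt_lt_sqrt (sq_nonneg u) (by linarith)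
    have hpos : 0 < u + Real.sqrt (u ^ 2 + a * b) := by
      have := neg_abs_le u
      linarith
    refine ⟨u + Real.sqrt (u ^ 2 + a * b), hpos, ?_⟩
    have hs := Real.sq_sqrt (show 0 ≤ u ^ 2 + a * b by positivity)
    field_simp
    linear_combination hs
  have hinj : Set.InjOn (fun x : ℝ => (x - a * b / x) / 2) (Set.Ioi 0) := by
    intro x hx y hy h
    have hx0 : 0 < x := hx
    have hy0 : 0 < y := hy
    simp only at h
    field_simp at h
    have h3 : (x - y) * (x * y + a * b) = 0 := by linear_combination h
    rcases mul_eq_zero.1 h3 with h4 | h4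
    · linarith
    · have : 0 < x * y + a * b := by positivity
      linarith
  have key := MeasureTheory.integral_image_eq_integral_abs_deriv_smul
    (f := fun x : ℝ => (x - a * b / x) / 2) (f' := fun x => (1 + a * b / x ^ 2) / 2)
    (s := Set.Ioi 0) measurableSet_Ioi
    (fun x hx => by
      have hx0 : x ≠ 0 := (Set.mem_Ioi.1 hx).ne'
      have h := (((hasDerivAt_id x).sub ((hasDerivAt_inv hx0).const_mul (a * b))).div_const 2)
      have h5 : HasDerivAt (fun x : ℝ => (x - a * b / x) / 2) ((1 + a * b / x ^ 2) / 2) x := by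
        refine h.congr_deriv ?_
        field_simp
        ring
      exact h5.hasDerivWithinAt) hinj f
  rw [him, MeasureTheory.setIntegral_univ, h2] at key
  have h3 : ∫ x in Set.Ioi (0:ℝ), |(1 + a * b / x ^ 2) / 2| • f ((x - a * b / x) / 2) =
      ∫ x in Set.Ioi (0:ℝ), 2 * (1 / Real.sqrt ((x ^ 2 + a ^ 2) * (x ^ 2 + b ^ 2))) := by
    refine MeasureTheory.setIntegral_congr_fun measurableSet_Ioi fun x hx => ?_
    have hx0 : 0 < x := hx
    simp only [smul_eq_mul, hf]
    have e1 : (((x - a * b / x) / 2) ^ 2 + ((a + b) / 2) ^ 2) * (((x - a * b / x) / 2) ^ 2 + a * b) =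
        ((x ^ 2 + a ^ 2) * (x ^ 2 + b ^ 2)) * ((x ^ 2 + a * b) / (4 * x ^ 2)) ^ 2 := by
      field_simp
      ring
    rw [e1, Real.sqrt_mul (by positivity), Real.sqrt_sq (by positivity), abs_of_pos (by positivity)]
    have : 0 < Real.sqrt ((x ^ 2 + a ^ 2) * (x ^ 2 + b ^ 2)) := Real.sqrt_pos.2 (by positivity)
    field_simp
    ring
  rw [h3, MeasureTheory.integral_const_mul] at key
  linarith

lemma JJ_scale {c : ℝ} (hc : 0 < c) (a b : ℝ) : JJ (c * a) (c * b) = JJ a b / c := by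
  rw [JJ, JJ, div_eq_mul_inv (∫ t in (0 : ℝ)..(Real.pi / 2), _) c, ← intervalIntegral.integral_mul_const]
  refine intervalIntegral.integral_congr fun t _ => ?_
  rw [show (c * a) ^ 2 * Real.cos t ^ 2 + (c * b) ^ 2 * Real.sin t ^ 2 =
    (a ^ 2 * Real.cos t ^ 2 + b ^ 2 * Real.sin t ^ 2) * c ^ 2 by ring,
    Real.sqrt_mul (by positivity), Real.sqrt_sq hc.le, ← one_div, ← one_div_mul_one_div]

lemma JJ_tendsto {u v : ℕ → ℝ} (hu : Tendsto u atTop (𝓝 1)) (hv : Tendsto v atTop (𝓝 1)) :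
    Tendsto (fun n => JJ (u n) (v n)) atTop (𝓝 (Real.pi / 2)) := by
  have h1 : Real.pi / 2 = ∫ t in (0 : ℝ)..(Real.pi / 2), (1:ℝ) := by simp
  have hu2 := hu.eventually (lt_mem_nhds (show (1/2 : ℝ) < 1 by norm_num))
  have hv2 := hv.eventually (lt_mem_nhds (show (1/2 : ℝ) < 1 by norm_num))
  have : Tendsto (fun n => JJ (u n) (v n)) atTop (𝓝 (∫ t in (0 : ℝ)..(Real.pi / 2), (1:ℝ))) := by
    refine intervalIntegral.tendsto_integral_filter_of_dominated_convergence (fun _ => (2:ℝ)) ?_ ?_ ?_ ?_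
    · filter_upwards with n
      apply Measurable.aestronglyMeasurable
      fun_prop
    · filter_upwards [hu2, hv2] with n h3 h4
      filter_upwards with t _
      have h5 : (1/2 : ℝ) ≤ Real.sqrt (u n ^ 2 * Real.cos t ^ 2 + v n ^ 2 * Real.sin t ^ 2) := by
        apply Real.le_sqrt_of_sq_le
        have := Real.sin_sq_add_cos_sq t
        have h6 : (1/2:ℝ)^2 ≤ u n ^ 2 := by gcongr
        have h7 : (1/2:ℝ)^2 ≤ v n ^ 2 := by gcongr
        nlinarith [mul_le_mul_of_nonneg_right h6 (sq_nonneg (Real.cos t)),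
          mul_le_mul_of_nonneg_right h7 (sq_nonneg (Real.sin t))]
      rw [Real.norm_eq_abs, abs_of_nonneg (by positivity), div_le_iff₀ (by linarith)]
      linarith
    · exact intervalIntegrable_const
    · filter_upwards with t _
      have h8 : Tendsto (fun n => Real.sqrt (u n ^ 2 * Real.cos t ^ 2 + v n ^ 2 * Real.sin t ^ 2))
          atTop (𝓝 (Real.sqrt (1 ^ 2 * Real.cos t ^ 2 + 1 ^ 2 * Real.sin t ^ 2))) :=
        (((hu.pow 2).mul_const _).add ((hv.pow 2).mul_const _)).sqrt
      have h9 : Real.sqrt (1 ^ 2 * Real.cos t ^ 2 + 1 ^ 2 * Real.sin t ^ 2) = 1 := by simp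
      rw [h9] at h8
      simpa only [one_div, inv_one] using h8.inv₀ one_ne_zero
  rwa [← h1] at this

lemma JJ_TF {s : ℝ} (hs : 0 < s) : JJ (TT s) (FF s) = Real.pi / 2 := by
  have h : ∀ n : ℕ, JJ (TT (2 ^ n * s)) (FF (2 ^ n * s)) = JJ (TT s) (FF s) := by
    intro n
    induction n with
    | zero => simp
    | succ n ih =>
      have hn : 0 < 2 ^ n * s := by positivity
      rw [← ih, ← JJ_step (TT_pos hn) (FF_pos hn), TF_am hn, TF_gm hn,
        Real.sqrt_sq (FF_pos (by positivity)).le]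
      rw [show (2:ℝ) ^ (n + 1) * s = 2 * (2 ^ n * s) by ring]
      congr 1
      ring
  have h2 := JJ_tendsto (TT_tendsto hs) (FF_tendsto hs)
  simp only [h] at h2
  exact tendsto_nhds_unique tendsto_const_nhds h2

lemma Kint_eq {x : ℝ} (hx : x ^ 2 ≤ 1) : Kint x = JJ 1 (Real.sqrt (1 - x ^ 2)) := by
  rw [Kint, JJ]
  refine intervalIntegral.integral_congr fun t _ => ?_
  rw [Real.sq_sqrt (by linarith)]
  congr 2
  have := Real.sin_sq_add_cos_sq t
  linear_combination -this

lemma Kint_TF {s x : ℝ} (hs : 0 < s) (h : 1 - x ^ 2 = (FF s / TT s) ^ 2) :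
    Kint x = TT s * (Real.pi / 2) := by
  have hT := TT_pos hs
  have hF := FF_pos hs
  have : x ^ 2 ≤ 1 := by nlinarith [sq_nonneg (FF s / TT s)]
  rw [Kint_eq this, h, Real.sqrt_sq (by positivity), ← JJ_TF hs]
  have := JJ_scale hT 1 (FF s / TT s)
  rw [mul_one, mul_div_cancel₀ _ hT.ne'] at this
  rw [this]
  field_simp

lemma Kint_mono {x y : ℝ} (hx : 0 ≤ x) (hxy : x < y) (hy : y < 1) : Kint x < Kint y := by
  have hpos : ∀ z : ℝ, 0 ≤ z → z < 1 → ∀ t, 0 < 1 - z ^ 2 * Real.sin t ^ 2 := by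
    intro z hz hz1 t
    have h1 : z ^ 2 < 1 := pow_lt_one₀ hz hz1 (by norm_num)
    have := Real.sin_sq_le_one t
    nlinarith [sq_nonneg (Real.sin t), sq_nonneg z]
  have hcont : ∀ z : ℝ, 0 ≤ z → z < 1 →
      Continuous (fun t => 1 / Real.sqrt (1 - z ^ 2 * Real.sin t ^ 2)) := by
    intro z hz hz1
    refine continuous_const.div (by fun_prop) fun t => (Real.sqrt_pos.2 (hpos z hz hz1 t)).ne'
  have h2 : x ^ 2 < y ^ 2 := by gcongr
  apply intervalIntegral.integral_lt_integral_of_continuousOn_of_le_of_exists_lt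
  · positivity
  · exact (hcont x hx (hxy.trans hy)).continuousOn
  · exact (hcont y (hx.trans hxy.le) hy).continuousOn
  · intro t _
    apply one_div_le_one_div_of_le (Real.sqrt_pos.2 (hpos y (hx.trans hxy.le) hy t))
    apply Real.sqrt_le_sqrt
    nlinarith [sq_nonneg (Real.sin t)]
  · refine ⟨Real.pi / 2, ⟨by positivity, le_rfl⟩, ?_⟩
    apply one_div_lt_one_div_of_lt (Real.sqrt_pos.2 (hpos y (hx.trans hxy.le) hy _))
    apply Real.sqrt_lt_sqrt (hpos y (hx.trans hxy.le) hy _).le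
    simp only [Real.sin_pi_div_two]
    linarith

theorem stmt_16 (r : ℝ) (hr : 0 < r) (q : ℝ) (hq : q = Real.exp (-Real.pi * Real.sqrt r))
    (k : ℝ) (hk0 : 0 < k) (hk1 : k < 1)
    (hK : Kint (Real.sqrt (1 - k ^ 2)) = Real.sqrt r * Kint k) :
    arctanh k = 4 * ∑' j : ℕ, arctanh (q ^ ((j : ℝ) + 1 / 2)) := by
  set s := Real.sqrt r with hs_def
  have hs : 0 < s := Real.sqrt_pos.2 hr
  have hh : 0 < s / 2 := by positivity
  have hi : 0 < s⁻¹ := by positivity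
  have hA := TT_pos hh
  have hB := FF_pos hh
  have hT := TT_pos hs
  have hF := FF_pos hs
  have am := TF_am hh
  have gm := TF_gm hh
  rw [mul_div_cancel₀ s two_ne_zero] at am gm
  set k₀ := TT (s / 2) / TT s - 1 with hk₀
  have hk₀F : k₀ = FF s⁻¹ / TT s⁻¹ := by
    have h1 := TF_am hi
    have h2 := TT_inv hh
    rw [show (s / 2)⁻¹ = 2 * s⁻¹ by field_simp] at h2
    rw [TT_inv hs] at h1 ⊢
    rw [h2] at h1
    have : FF s⁻¹ = s * (TT (s / 2) - TT s) := by linear_combination h1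
    rw [this, hk₀]
    field_simp
  have hk₀0 : 0 < k₀ := by
    rw [hk₀F]; exact div_pos (FF_pos hi) (TT_pos hi)
  have hk₀1 : k₀ < 1 := by
    rw [hk₀, sub_lt_iff_lt_add, div_lt_iff₀ hT]
    linarith
  have hk₀c : 1 - k₀ ^ 2 = (FF s / TT s) ^ 2 := by
    rw [hk₀, div_pow, ← gm]
    field_simp
    linear_combination TT (s / 2) * am * (-1)
  have K1 : Kint k₀ = TT s * (Real.pi / 2) := Kint_TF hs hk₀c
  have K2 : Kint (Real.sqrt (1 - k₀ ^ 2)) = s * Kint k₀ := by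
    rw [K1, ← mul_assoc, ← TT_inv hs]
    refine Kint_TF hi ?_
    rw [← hk₀F, Real.sq_sqrt (by nlinarith)]
    ring
  have hanti : ∀ x y : ℝ, 0 < x → x < y → y < 1 →
      Kint (Real.sqrt (1 - y ^ 2)) < Kint (Real.sqrt (1 - x ^ 2)) := by
    intro x y hx hxy hy
    apply Kint_mono (Real.sqrt_nonneg _)
    · exact Real.sqrt_lt_sqrt (by nlinarith) (by nlinarith)
    · rw [Real.sqrt_lt' one_pos]; nlinarith
  have hkk : k = k₀ := by
    rcases lt_trichotomy k k₀ with h | h | h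
    · have h1 := Kint_mono hk0.le h hk₀1
      have h2 := hanti k k₀ hk0 h hk₀1
      rw [hK, K2] at h2
      nlinarith
    · exact h
    · have h1 := Kint_mono hk₀0.le h hk1
      have h2 := hanti k₀ k hk₀0 h hk1
      rw [hK, K2] at h2
      nlinarith
  -- the product side
  set p := Real.exp (-Real.pi * (s / 2)) with hp
  have hp0 : 0 < p := Real.exp_pos _
  have hp1 : p < 1 := q_lt hh
  have hterm : ∀ j : ℕ, q ^ ((j : ℝ) + 1 / 2) = p ^ (2 * j + 1) := by
    intro j
    rw [hq, ← Real.exp_mul, hp, ← Real.exp_nat_mul]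
    congr 1
    push_cast
    ring
  have hpj0 : ∀ j : ℕ, 0 < p ^ (2 * j + 1) := fun j => by positivity
  have hpj1 : ∀ j : ℕ, p ^ (2 * j + 1) < 1 := fun j => pow_lt_one₀ hp0.le hp1 (by omega)
  have h4 := th_ne hp0 hp1
  have h3 := th_pos hp0 hp1
  have hlim := th_ratio hp0 hp1 h4
  have hne : th 1 p / th (-1) p ≠ 0 := div_ne_zero h3.ne' h4
  have hlog := (hlim.log hne).div_const 4
  have hak : arctanh k = Real.log (th 1 p / th (-1) p) := by
    have : (1 + k) / (1 - k) = (th 1 p / th (-1) p) ^ 2 := by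
      have e1 : (th 1 p / th (-1) p) ^ 2 = TT (s / 2) / FF (s / 2) := by
        rw [div_pow]; rfl
      rw [e1, hkk, div_eq_div_iff (by linarith) hB.ne', hk₀]
      field_simp
      linear_combination TT (s / 2) * am
    rw [arctanh, this, Real.log_pow]
    push_cast
    ring
  have hsum : HasSum (fun j : ℕ => arctanh (q ^ ((j : ℝ) + 1 / 2)))
      (Real.log (th 1 p / th (-1) p) / 4) := by
    rw [hasSum_iff_tendsto_nat_of_nonneg]
    · refine hlog.congr fun n => ?_
      rw [Real.log_prod, Finset.sum_div]
      · refine Finset.sum_congr rfl fun j _ => ?_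
        rw [hterm, arctanh, Real.log_pow]
        push_cast
        ring
      · intro j _
        have h5 := hpj0 j
        have h6 : 0 < 1 - p ^ (2 * j + 1) := by linarith [hpj1 j]
        positivity
    · intro j
      rw [hterm, arctanh]
      have h5 := hpj0 j
      have h6 := hpj1 j
      apply div_nonneg _ zero_le_two
      apply Real.log_nonneg
      rw [le_div_iff₀ (by linarith)]
      linarith
  rw [hsum.tsum_eq, hak]
  ring
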